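/- Let t = (t₁, t₂, t₃) ∈ (ZMod r)³ be arbitrary weights. Let (x₁, x₂, x₃) be a combinatorial line in [3]^n with x_i = w(S,i), where w = x₁ and S is the union of q pairwise disjoint, pairwise non-adjacent intervals of [n]. Let w₀, w₁, ..., w_q be the (nonempty) maximal subwords of w⁺ lying outside S, listed in order, so that w_{j-1} precedes the j-th interval of S and w_j follows it; let f_j denote the first letter of w_j and ℓ_j the last letter of w_{j-1}. Then for each i ∈ [3]: T⁺(x_i) = T(w₀) + h_i(ℓ₁, f₁) + T(w₁) + h_i(ℓ₂, f₂) + ... + h_i(ℓ_q, f_q) + T(w_q) in ZMod r, where h_i is the symmetric function on [3] × [3] given by: h₁(1,1) = −t₁, h₁(2,2) = t₁, h₁(3,3) = t₁, h₁(2,3) = t₁, h₁(3,1) = 0, h₁(1,2) = 0; h₂(1,1) = t₂, h₂(2,2) = −t₂, h₂(3,3) = t₂, h₂(2,3) = 0, h₂(3,1) = t₂, h₂(1,2) = 0; h₃(1,1) = t₃, h₃(2,2) = t₃, h₃(3,3) = −t₃, h₃(2,3) = 0, h₃(3,1) = 0, h₃(1,2) = t₃. -/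

import Mathlib

/- A word over `[3]` of length `n` is a function `Fin n → Fin 3`
(letter `k` corresponds to index `k - 1`).
`updSet w S i` is the word `w(S, i)`. -/
open Classical in
noncomputable def updSet {n m : ℕ} (w : Fin n → Fin m) (S : Set (Fin n)) (i : Fin m) :
    Fin n → Fin m := fun j => if j ∈ S then i else w j

/-- `T(w)` for a word given as a list: sum of the weights `t` over the contraction of
the word (maximal runs of equal consecutive letters contracted to a single letter). -/
def Tword {r : ℕ} (t : Fin 3 → ZMod r) (l : List (Fin 3)) : ZMod r :=
  ((l.destutter (· ≠ ·)).map t).sum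

/-- `T⁺(w) = T(w⁺)`, where `w⁺` is `w` with the letter `1` (index `0`) inserted at the
start and at the end. -/
def Tplus {n r : ℕ} (t : Fin 3 → ZMod r) (w : Fin n → Fin 3) : ZMod r :=
  Tword t ((0 : Fin 3) :: (List.ofFn w ++ [(0 : Fin 3)]))

/-- The symmetric functions `h_i(ℓ, f)` from the Claim (letters `1,2,3` are indices
`0,1,2`).  This closed form reproduces exactly the table of the paper:
`h_i(ℓ,ℓ) = -t_i` if `ℓ = i` and `t_i` otherwise; for `ℓ ≠ f`, `h_i(ℓ,f) = 0` if
`i ∈ {ℓ,f}` and `t_i` otherwise. -/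
def hfun {r : ℕ} (t : Fin 3 → ZMod r) (i ℓ f : Fin 3) : ZMod r :=
  if ℓ = f then (if ℓ = i then - t i else t i)
  else (if i = ℓ ∨ i = f then 0 else t i)

theorem Tword_cons_cons {r : ℕ} (t : Fin 3 → ZMod r) (a b : Fin 3) (l : List (Fin 3)) :
    Tword t (a :: b :: l) = (if a = b then 0 else t a) + Tword t (b :: l) := by
  unfold Tword
  rw [List.destutter_cons_cons, List.destutter_cons']
  by_cases h : a = b <;> simp [h]

theorem Tword_append {r : ℕ} (t : Fin 3 → ZMod r) (u v : List (Fin 3))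
    (hu : u ≠ []) (hv : v ≠ []) :
    Tword t (u ++ v) =
      Tword t u + Tword t v - if u.getLast hu = v.head hv then t (u.getLast hu) else 0 := by
  induction u with
  | nil => exact absurd rfl hu
  | cons a u ih =>
    cases u with
    | nil =>
      obtain ⟨b, l, rfl⟩ := List.exists_cons_of_ne_nil hv
      have ha : Tword t [a] = t a := by simp [Tword]
      by_cases h : a = b
      · subst h
        simp [Tword_cons_cons, ha]
      · simp [Tword_cons_cons, ha, h]
    | cons c u =>
      have hcu := ih (List.cons_ne_nil c u)
      rw [List.cons_append] at hcu
      simp only [List.cons_append, Tword_cons_cons, List.getLast_cons_cons, hcu, add_sub_assoc,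
        add_assoc]
      congr

theorem Tword_replicate_succ {r : ℕ} (t : Fin 3 → ZMod r) (i : Fin 3) (k : ℕ) :
    Tword t (List.replicate (k + 1) i) = t i := by
  induction k with
  | zero => simp [Tword]
  | succ k ih =>
    rw [List.replicate_succ] at ih
    rw [List.replicate_succ, List.replicate_succ, Tword_cons_cons, ih]
    simp

/-- Inserting a nonempty run of the letter `i` between two nonempty words changes the sum of
their weights by `hfun`. -/
theorem Tword_append_replicate_append {r : ℕ} (t : Fin 3 → ZMod r) (i : Fin 3) {m : ℕ}
    (hm : 0 < m) (u v : List (Fin 3)) (hu : u ≠ []) (hv : v ≠ []) :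
    Tword t (u ++ (List.replicate m i ++ v)) =
      Tword t u + (hfun t i (u.getLast hu) (v.head hv) + Tword t v) := by
  obtain ⟨k, rfl⟩ := Nat.exists_eq_add_of_lt hm
  rw [Nat.zero_add]
  have hrep : List.replicate (k + 1) i ≠ [] := by simp
  rw [Tword_append t u _ hu (List.append_ne_nil_of_left_ne_nil hrep v),
    Tword_append t _ v hrep hv, Tword_replicate_succ, List.head_append_of_ne_nil hrep,
    List.head_replicate, List.getLast_replicate]
  generalize u.getLast hu = a
  generalize v.head hv = b
  unfold hfun
  by_cases hai : a = i
  · subst hai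
    by_cases hab : a = b <;> simp [hab] <;> ring
  · by_cases hib : i = b
    · subst hib
      simp [hai]
    · by_cases hab : a = b
      · subst hab
        simp [hai, hib]
      · simp [hai, hib, hab, Ne.symm hai]

theorem Tword_append_flatten_ofFn {r q : ℕ} (t : Fin 3 → ZMod r) (i : Fin 3)
    (ws : Fin (q + 1) → List (Fin 3)) (ms : Fin q → ℕ)
    (hws : ∀ j, ws j ≠ []) (hms : ∀ j, 0 < ms j) :
    Tword t (ws 0 ++
        (List.ofFn fun j : Fin q => List.replicate (ms j) i ++ ws j.succ).flatten) =
      Tword t (ws 0) +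
        ∑ j : Fin q,
          (hfun t i ((ws j.castSucc).getLast (hws j.castSucc))
              ((ws j.succ).head (hws j.succ)) +
            Tword t (ws j.succ)) := by
  induction q with
  | zero => simp
  | succ q ih =>
    have hrest := ih (fun j => ws j.succ) (fun j => ms j.succ) (fun j => hws j.succ)
      (fun j => hms j.succ)
    rw [List.ofFn_succ, List.flatten_cons, List.append_assoc,
      Tword_append_replicate_append t i (hms 0) _ _ (hws 0)
        (List.append_ne_nil_of_left_ne_nil (hws (Fin.succ 0)) _),
      hrest, List.head_append_of_ne_nil (hws (Fin.succ 0)), Fin.sum_univ_succ]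
    simp only [Fin.castSucc_zero, Fin.succ_castSucc]
    ring

/-- The Claim.  Let `(x₁, x₂, x₃)` be a combinatorial line with `x_i = w(S, i)`, where
`S` is the union of `q` pairwise disjoint, pairwise non-adjacent intervals.  The
decomposition of `w⁺` outside `S` into the (nonempty) maximal subwords
`w₀, w₁, …, w_q`, with the `j`-th wildcard interval (of size `ms j > 0`) lying between
`w_{j-1}` and `w_j`, is recorded by the hypothesis `hdecomp`, which states that for each
`i` the word `x_i⁺` is `w₀ ++ i…i ++ w₁ ++ i…i ++ ⋯ ++ i…i ++ w_q`.  Then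
`T⁺(x_i) = T(w₀) + h_i(ℓ₁,f₁) + T(w₁) + ⋯ + h_i(ℓ_q,f_q) + T(w_q)`, where `ℓ_j` is the
last letter of `w_{j-1}` and `f_j` the first letter of `w_j`. -/
theorem stmt2 (r n q : ℕ) (t : Fin 3 → ZMod r) (w : Fin n → Fin 3) (S : Set (Fin n))
    (ws : Fin (q + 1) → List (Fin 3)) (ms : Fin q → ℕ)
    (hws : ∀ j, ws j ≠ []) (hms : ∀ j, 0 < ms j)
    (hdecomp : ∀ i : Fin 3,
      (0 : Fin 3) :: (List.ofFn (updSet w S i) ++ [(0 : Fin 3)]) =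
        ws 0 ++ (List.ofFn fun j : Fin q =>
          List.replicate (ms j) i ++ ws j.succ).flatten)
    (i : Fin 3) :
    Tplus t (updSet w S i) =
      Tword t (ws 0) +
        ∑ j : Fin q,
          (hfun t i ((ws j.castSucc).getLast (hws j.castSucc))
              ((ws j.succ).head (hws j.succ)) +
            Tword t (ws j.succ)) := by
  rw [Tplus, hdecomp i, Tword_append_flatten_ofFn t i ws ms hws hms]
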